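/- Let n ≥ 3 and let D = (V,E,w) be a vertex-weighted oriented cycle on vertices x_1,...,x_n with edges (x_1,x_2), (x_2,x_3), ..., (x_{n−1},x_n), (x_n,x_1), and suppose w(x) ≥ 2 for every vertex x. Then reg(I(D)) = (Σ_{x ∈ V} w(x)) − |E| + 1. -/

import Mathlib

open MvPolynomial

noncomputable section

namespace WOG

variable {k : Type} [Field k]

/-- The maximal graded ideal `(x : x ∈ V)` of the polynomial ring. -/
def mIdeal (k V : Type) [Field k] : Ideal (MvPolynomial V k) :=
  Ideal.span (Set.range (X : V → MvPolynomial V k))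

/-- The edge ideal `I(D) = (x * y^{w(y)} : (x,y) ∈ E)` of a vertex-weighted
oriented graph `D = (V, E, w)`. -/
def edgeIdeal (k : Type) [Field k] {V : Type} (E : Set (V × V)) (w : V → ℕ) :
    Ideal (MvPolynomial V k) :=
  Ideal.span {p : MvPolynomial V k | ∃ e ∈ E, p = X e.1 * X e.2 ^ w e.2}

/-- A minimal graded free resolution `⋯ → F₁ → F₀ → I → 0` of an ideal
`I` of the polynomial ring `S = k[x : x ∈ V]`, where `Fᵢ` is the graded free
module with (finite) homogeneous basis `ι i` whose element `a` sits in degree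
`deg i a` (i.e. `Fᵢ = ⊕_a S(- deg i a)`), the maps are graded (degree-preserving)
`S`-linear maps, the complex is exact, and all the matrix entries of the
differentials lie in the maximal graded ideal `𝔪 = (x : x ∈ V)` (minimality). -/
structure MinFreeRes {V : Type} (I : Ideal (MvPolynomial V k)) where
  ι : ℕ → Type
  finite : ∀ i, Finite (ι i)
  deg : ∀ i, ι i → ℕ
  aug : ((ι 0) →₀ MvPolynomial V k) →ₗ[MvPolynomial V k] MvPolynomial V k
  d : ∀ i, ((ι (i + 1)) →₀ MvPolynomial V k) →ₗ[MvPolynomial V k] ((ι i) →₀ MvPolynomial V k)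
  aug_range : LinearMap.range aug = I
  exact_zero : LinearMap.range (d 0) = LinearMap.ker aug
  exact_succ : ∀ i, LinearMap.range (d (i + 1)) = LinearMap.ker (d i)
  aug_homog : ∀ a, (aug (Finsupp.single a 1)).IsHomogeneous (deg 0 a)
  d_homog : ∀ i a b, (d i (Finsupp.single a 1)) b = 0 ∨
      ∃ e, deg (i + 1) a = deg i b + e ∧ ((d i (Finsupp.single a 1)) b).IsHomogeneous e
  minimal : ∀ i a b, (d i (Finsupp.single a 1)) b ∈ mIdeal k V

/-- The graded Betti number `β_{i,j}(I)`, read off from a minimal graded free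
resolution: the number of basis elements of `Fᵢ` of degree `j`. -/
def MinFreeRes.betti {V : Type} {I : Ideal (MvPolynomial V k)} (R : MinFreeRes I)
    (i j : ℕ) : ℕ :=
  Nat.card {a : R.ι i // R.deg i a = j}

/-- The set `{j - i : β_{i,j}(I) ≠ 0}`; its greatest element is the
Castelnuovo–Mumford regularity `reg I`. -/
def MinFreeRes.regSet {V : Type} {I : Ideal (MvPolynomial V k)} (R : MinFreeRes I) :
    Set ℤ :=
  {t : ℤ | ∃ i j : ℕ, R.betti i j ≠ 0 ∧ t = (j : ℤ) - (i : ℤ)}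

/-- The set `{i : β_{i,j}(I) ≠ 0 for some j}`; its greatest element is the
projective dimension `pd I`. -/
def MinFreeRes.pdSet {V : Type} {I : Ideal (MvPolynomial V k)} (R : MinFreeRes I) :
    Set ℕ :=
  {i : ℕ | ∃ j : ℕ, R.betti i j ≠ 0}

/-- The set of lengths of `I`-regular sequences contained in the maximal graded
ideal `𝔪 = (x : x ∈ V)`; its greatest element is `depth I`. -/
def depthSet (k : Type) [Field k] {V : Type} (I : Ideal (MvPolynomial V k)) : Set ℕ :=
  {n : ℕ | ∃ rs : List (MvPolynomial V k), rs.length = n ∧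
    (∀ r ∈ rs, r ∈ mIdeal k V) ∧ RingTheory.Sequence.IsRegular (↥I) rs}

end WOG

namespace WOG

section Comparison

variable {k : Type} [Field k] {V : Type}

theorem mem_mIdeal_iff {p : MvPolynomial V k} : p ∈ mIdeal k V ↔ coeff 0 p = 0 := by
  rw [mIdeal, ← Set.image_univ, mem_ideal_span_X_image]
  constructor
  · intro h
    by_contra h0
    obtain ⟨i, -, hi⟩ := h 0 (mem_support_iff.mpr h0)
    exact hi rfl
  · intro h u hu
    by_contra! hc
    have : u = 0 := Finsupp.ext fun i => hc i (Set.mem_univ i)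
    exact mem_support_iff.mp hu (this ▸ h)

theorem one_notMem_mIdeal : (1 : MvPolynomial V k) ∉ mIdeal k V := by
  simp [mem_mIdeal_iff]

theorem homogeneousComponent_mul {p q : MvPolynomial V k} {e : ℕ} (hq : q.IsHomogeneous e)
    (n : ℕ) : homogeneousComponent n (p * q) =
      if e ≤ n then homogeneousComponent (n - e) p * q else 0 := by
  let _ : GradedAlgebra (homogeneousSubmodule V k) := MvPolynomial.gradedAlgebra
  have h := DirectSum.coe_decompose_mul_of_right_mem (homogeneousSubmodule V k) (a := p) n
    ((mem_homogeneousSubmodule e q).mpr hq)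
  have key : ∀ (r : MvPolynomial V k) (i : ℕ),
      (DirectSum.decompose (homogeneousSubmodule V k) r i : MvPolynomial V k) =
        homogeneousComponent i r := fun r i => decomposition.decompose'_apply r i
  rwa [key, key] at h

/-- The polynomial `p` is zero or homogeneous of degree `D - c` with `c ≤ D`. -/
def IsShiftedHomog (c D : ℕ) (p : MvPolynomial V k) : Prop :=
  p = 0 ∨ ∃ e, D = c + e ∧ p.IsHomogeneous e

/-- The homogeneous component of degree `D` for the grading shifted by `c`. -/
def shiftedComponent (c D : ℕ) : MvPolynomial V k →ₗ[k] MvPolynomial V k :=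
  if c ≤ D then homogeneousComponent (D - c) else 0

theorem isShiftedHomog_shiftedComponent (c D : ℕ) (p : MvPolynomial V k) :
    IsShiftedHomog c D (shiftedComponent c D p) := by
  unfold shiftedComponent
  split_ifs with h
  · exact Or.inr ⟨D - c, by omega, homogeneousComponent_isHomogeneous _ _⟩
  · exact Or.inl rfl

theorem IsShiftedHomog.shiftedComponent_eq {c D : ℕ} {p : MvPolynomial V k}
    (h : IsShiftedHomog c D p) : shiftedComponent c D p = p := by
  obtain rfl | ⟨e, rfl, he⟩ := h
  · simp
  · simp [shiftedComponent, homogeneousComponent_of_mem ((mem_homogeneousSubmodule e p).mpr he)]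

theorem shiftedComponent_mul {c c' : ℕ} (D : ℕ) {p q : MvPolynomial V k}
    (hq : IsShiftedHomog c c' q) :
    shiftedComponent c D (p * q) = shiftedComponent c' D p * q := by
  obtain rfl | ⟨e, rfl, he⟩ := hq
  · simp
  · unfold shiftedComponent
    by_cases h : c ≤ D
    · rw [if_pos h, homogeneousComponent_mul he]
      by_cases h' : e ≤ D - c
      · rw [if_pos h', if_pos (by omega), Nat.sub_sub]
      · rw [if_neg h', if_neg (by omega)]
        simp
    · rw [if_neg h, if_neg (by omega)]
      simp

variable {ι κ : Type}

/-- An element of the graded free module with basis degrees `deg` is homogeneous of degree `D`. -/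
def IsHomogVec (deg : ι → ℕ) (D : ℕ) (v : ι →₀ MvPolynomial V k) : Prop :=
  ∀ b, IsShiftedHomog (deg b) D (v b)

/-- The homogeneous component of degree `D` in the graded free module with basis degrees `deg`. -/
def vecComponent (deg : ι → ℕ) (D : ℕ) :
    (ι →₀ MvPolynomial V k) →ₗ[k] (ι →₀ MvPolynomial V k) :=
  Finsupp.lsum k fun b => Finsupp.lsingle b ∘ₗ shiftedComponent (deg b) D

theorem vecComponent_single (deg : ι → ℕ) (D : ℕ) (b : ι) (p : MvPolynomial V k) :
    vecComponent deg D (Finsupp.single b p) =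
      Finsupp.single b (shiftedComponent (deg b) D p) := by
  simp [vecComponent]

theorem vecComponent_apply (deg : ι → ℕ) (D : ℕ) (v : ι →₀ MvPolynomial V k) (b : ι) :
    vecComponent deg D v b = shiftedComponent (deg b) D (v b) := by
  classical
  induction v using Finsupp.induction_linear with
  | zero => simp
  | add f g hf hg => simp [hf, hg]
  | single a p =>
    rw [vecComponent_single, Finsupp.single_apply, Finsupp.single_apply]
    split_ifs with h
    · rw [h]
    · simp

theorem isHomogVec_vecComponent (deg : ι → ℕ) (D : ℕ) (v : ι →₀ MvPolynomial V k) :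
    IsHomogVec deg D (vecComponent deg D v) := fun b => by
  rw [vecComponent_apply]
  exact isShiftedHomog_shiftedComponent _ _ _

theorem IsHomogVec.vecComponent_eq {deg : ι → ℕ} {D : ℕ} {v : ι →₀ MvPolynomial V k}
    (h : IsHomogVec deg D v) : vecComponent deg D v = v := by
  ext1 b
  rw [vecComponent_apply, (h b).shiftedComponent_eq]

theorem map_single_eq_mul (f : (κ →₀ MvPolynomial V k) →ₗ[MvPolynomial V k] MvPolynomial V k)
    (a : κ) (p : MvPolynomial V k) :
    f (Finsupp.single a p) = p * f (Finsupp.single a 1) := by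
  rw [← smul_eq_mul, ← map_smul, Finsupp.smul_single, smul_eq_mul, mul_one]

theorem map_apply_mem {J : Ideal (MvPolynomial V k)}
    {f : (κ →₀ MvPolynomial V k) →ₗ[MvPolynomial V k] (ι →₀ MvPolynomial V k)}
    {v : κ →₀ MvPolynomial V k} {b : ι} (h : ∀ a, v a * f (Finsupp.single a 1) b ∈ J) :
    f v b ∈ J := by
  rw [← Finsupp.sum_single v, Finsupp.sum, map_sum, Finsupp.finsetSum_apply]
  refine sum_mem fun a _ => ?_
  have := map_single_eq_mul (Finsupp.lapply b ∘ₗ f) a (v a)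
  simp only [LinearMap.comp_apply, Finsupp.lapply_apply] at this
  rw [this]
  exact h a

theorem map_vecComponent
    {f : (κ →₀ MvPolynomial V k) →ₗ[MvPolynomial V k] MvPolynomial V k} {deg : κ → ℕ} {c : ℕ}
    (hf : ∀ a, IsShiftedHomog c (deg a) (f (Finsupp.single a 1))) (D : ℕ)
    (v : κ →₀ MvPolynomial V k) :
    f (vecComponent deg D v) = shiftedComponent c D (f v) := by
  induction v using Finsupp.induction_linear with
  | zero => simp
  | add x y hx hy => simp [hx, hy]
  | single a p =>
    rw [vecComponent_single, map_single_eq_mul, map_single_eq_mul f a p,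
      shiftedComponent_mul D (hf a)]

/-- A linear map of graded free modules which preserves degrees. -/
def IsGradedMap (deg' : κ → ℕ) (deg : ι → ℕ)
    (f : (κ →₀ MvPolynomial V k) →ₗ[MvPolynomial V k] (ι →₀ MvPolynomial V k)) : Prop :=
  ∀ a, IsHomogVec deg (deg' a) (f (Finsupp.single a 1))

theorem IsGradedMap.map_vecComponent {deg' : κ → ℕ} {deg : ι → ℕ}
    {f : (κ →₀ MvPolynomial V k) →ₗ[MvPolynomial V k] (ι →₀ MvPolynomial V k)}
    (hf : IsGradedMap deg' deg f) (D : ℕ) (v : κ →₀ MvPolynomial V k) :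
    f (vecComponent deg' D v) = vecComponent deg D (f v) := by
  ext1 b
  rw [vecComponent_apply]
  exact WOG.map_vecComponent (f := Finsupp.lapply b ∘ₗ f) (fun a => hf a b) D v

theorem IsGradedMap.isHomogVec {deg' : κ → ℕ} {deg : ι → ℕ}
    {f : (κ →₀ MvPolynomial V k) →ₗ[MvPolynomial V k] (ι →₀ MvPolynomial V k)}
    (hf : IsGradedMap deg' deg f) {D : ℕ} {v : κ →₀ MvPolynomial V k}
    (hv : IsHomogVec deg' D v) : IsHomogVec deg D (f v) := by
  rw [← hv.vecComponent_eq, hf.map_vecComponent]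
  exact isHomogVec_vecComponent _ _ _

/-- A linear map out of a free module lifts along `g` when it does so on the basis; the lift can be
chosen to satisfy any property `P` of the chosen preimages. -/
theorem exists_lift_of_single {S M N : Type} [CommRing S] [AddCommGroup M] [AddCommGroup N]
    [Module S M] [Module S N] {g : M →ₗ[S] N} {f : (κ →₀ S) →ₗ[S] N} {P : κ → M → Prop}
    (h : ∀ a, ∃ y, g y = f (Finsupp.single a 1) ∧ P a y) :
    ∃ φ : (κ →₀ S) →ₗ[S] M, (∀ x, g (φ x) = f x) ∧ ∀ a, P a (φ (Finsupp.single a 1)) := by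
  choose y hy hP using h
  refine ⟨Finsupp.linearCombination S y, fun x => ?_, fun a => by simpa using hP a⟩
  suffices H : g ∘ₗ Finsupp.linearCombination S y = f from LinearMap.congr_fun H x
  ext a
  simp [hy]

namespace MinFreeRes

variable {I : Ideal (MvPolynomial V k)}

theorem isGradedMap_d (R : MinFreeRes I) (i : ℕ) :
    IsGradedMap (R.deg (i + 1)) (R.deg i) (R.d i) :=
  fun a b => R.d_homog i a b

theorem d_d (R : MinFreeRes I) (i : ℕ) (x : R.ι (i + 2) →₀ MvPolynomial V k) :
    R.d i (R.d (i + 1) x) = 0 :=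
  LinearMap.mem_ker.mp (R.exact_succ i ▸ LinearMap.mem_range_self _ x)

theorem aug_d (R : MinFreeRes I) (x : R.ι 1 →₀ MvPolynomial V k) : R.aug (R.d 0 x) = 0 :=
  LinearMap.mem_ker.mp (R.exact_zero ▸ LinearMap.mem_range_self _ x)

theorem d_apply_mem (R : MinFreeRes I) (i : ℕ) (x : R.ι (i + 1) →₀ MvPolynomial V k)
    (b : R.ι i) : R.d i x b ∈ mIdeal k V :=
  map_apply_mem fun a => Ideal.mul_mem_left _ _ (R.minimal i a b)

theorem exists_lift_zero (R T : MinFreeRes I) :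
    ∃ φ : (R.ι 0 →₀ MvPolynomial V k) →ₗ[MvPolynomial V k] (T.ι 0 →₀ MvPolynomial V k),
      (∀ x, T.aug (φ x) = R.aug x) ∧ IsGradedMap (R.deg 0) (T.deg 0) φ := by
  refine exists_lift_of_single fun a => ?_
  have hmem : R.aug (Finsupp.single a 1) ∈ LinearMap.range T.aug := by
    rw [T.aug_range]
    exact R.aug_range.le (LinearMap.mem_range_self _ _)
  obtain ⟨y, hy⟩ := hmem
  have hT : ∀ b, IsShiftedHomog 0 (T.deg 0 b) (T.aug (Finsupp.single b 1)) :=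
    fun b => Or.inr ⟨_, (zero_add _).symm, T.aug_homog b⟩
  have hR : IsShiftedHomog 0 (R.deg 0 a) (R.aug (Finsupp.single a 1)) :=
    Or.inr ⟨_, (zero_add _).symm, R.aug_homog a⟩
  exact ⟨vecComponent (T.deg 0) (R.deg 0 a) y,
    by rw [map_vecComponent hT, hy, hR.shiftedComponent_eq], isHomogVec_vecComponent _ _ _⟩

theorem exists_lift_succ (R T : MinFreeRes I) (i : ℕ)
    {φ : (R.ι i →₀ MvPolynomial V k) →ₗ[MvPolynomial V k] (T.ι i →₀ MvPolynomial V k)}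
    (hφ : IsGradedMap (R.deg i) (T.deg i) φ)
    (hd : ∀ x, φ (R.d i x) ∈ LinearMap.range (T.d i)) :
    ∃ ψ : (R.ι (i + 1) →₀ MvPolynomial V k) →ₗ[MvPolynomial V k]
        (T.ι (i + 1) →₀ MvPolynomial V k),
      (∀ x, T.d i (ψ x) = φ (R.d i x)) ∧ IsGradedMap (R.deg (i + 1)) (T.deg (i + 1)) ψ := by
  refine exists_lift_of_single (f := φ ∘ₗ R.d i) fun a => ?_
  obtain ⟨y, hy⟩ := hd (Finsupp.single a 1)
  refine ⟨vecComponent (T.deg (i + 1)) (R.deg (i + 1) a) y, ?_, isHomogVec_vecComponent _ _ _⟩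
  rw [(T.isGradedMap_d i).map_vecComponent, hy]
  exact (hφ.isHomogVec (R.isGradedMap_d i a)).vecComponent_eq

/-- Comparison of two resolutions in homological degree `i`: there are degree-preserving maps `φ`
and `ψ` in both directions and a map `h` such that `ψ ∘ φ - id - d ∘ h` vanishes modulo the maximal
graded ideal, together with the compatibilities that allow one to pass to degree `i + 1`. -/
theorem exists_comparison (R T : MinFreeRes I) (i : ℕ) :
    ∃ (φ : (R.ι i →₀ MvPolynomial V k) →ₗ[MvPolynomial V k] (T.ι i →₀ MvPolynomial V k))
      (ψ : (T.ι i →₀ MvPolynomial V k) →ₗ[MvPolynomial V k] (R.ι i →₀ MvPolynomial V k))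
      (h : (R.ι i →₀ MvPolynomial V k) →ₗ[MvPolynomial V k] (R.ι (i + 1) →₀ MvPolynomial V k)),
      IsGradedMap (R.deg i) (T.deg i) φ ∧ IsGradedMap (T.deg i) (R.deg i) ψ ∧
      (∀ x, φ (R.d i x) ∈ LinearMap.range (T.d i)) ∧
      (∀ x, ψ (T.d i x) ∈ LinearMap.range (R.d i)) ∧
      (∀ x, ψ (φ (R.d i x)) - R.d i x - R.d i (h (R.d i x)) = 0) ∧
      ∀ x b, (ψ (φ x) - x - R.d i (h x)) b ∈ mIdeal k V := by
  induction i with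
  | zero =>
    obtain ⟨φ, hφ, hφg⟩ := exists_lift_zero R T
    obtain ⟨ψ, hψ, hψg⟩ := exists_lift_zero T R
    obtain ⟨h, hh, -⟩ := exists_lift_of_single (g := R.d 0) (f := ψ ∘ₗ φ - LinearMap.id)
      (P := fun _ _ => True) fun a => by
        have : ψ (φ (Finsupp.single a 1)) - Finsupp.single a 1 ∈ LinearMap.range (R.d 0) := by
          rw [R.exact_zero, LinearMap.mem_ker]
          simp [hφ, hψ]
        simpa using this
    have hh' : ∀ x, ψ (φ x) - x - R.d 0 (h x) = 0 := fun x => by simp [hh]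
    refine ⟨φ, ψ, h, hφg, hψg, fun x => ?_, fun x => ?_, fun x => hh' _, fun x b => ?_⟩
    · rw [T.exact_zero, LinearMap.mem_ker, hφ, R.aug_d]
    · rw [R.exact_zero, LinearMap.mem_ker, hψ, T.aug_d]
    · simp [hh']
  | succ i ih =>
    obtain ⟨φ, ψ, h, hφg, hψg, hφ, hψ, hh, -⟩ := ih
    obtain ⟨φ', hφ', hφg'⟩ := exists_lift_succ R T i hφg hφ
    obtain ⟨ψ', hψ', hψg'⟩ := exists_lift_succ T R i hψg hψ
    obtain ⟨h', hh', -⟩ := exists_lift_of_single (g := R.d (i + 1))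
      (f := ψ' ∘ₗ φ' - LinearMap.id - h ∘ₗ R.d i) (P := fun _ _ => True) fun a => by
        have : ψ' (φ' (Finsupp.single a 1)) - Finsupp.single a 1 - h (R.d i (Finsupp.single a 1)) ∈
            LinearMap.range (R.d (i + 1)) := by
          rw [R.exact_succ, LinearMap.mem_ker]
          simpa [hφ', hψ'] using hh (Finsupp.single a 1)
        simpa using this
    have key : ∀ x, ψ' (φ' x) - x - R.d (i + 1) (h' x) = h (R.d i x) := fun x => by
      simp [hh']
    refine ⟨φ', ψ', h', hφg', hψg', fun x => ?_, fun x => ?_, fun x => ?_, fun x b => ?_⟩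
    · rw [T.exact_succ, LinearMap.mem_ker, hφ', R.d_d, map_zero]
    · rw [R.exact_succ, LinearMap.mem_ker, hψ', T.d_d, map_zero]
    · rw [key, R.d_d, map_zero]
    · rw [key]
      exact map_apply_mem fun a => Ideal.mul_mem_right _ _ (R.d_apply_mem i x a)

/-- Two minimal graded free resolutions of an ideal have the same basis degrees. -/
theorem exists_deg_eq (R T : MinFreeRes I) (i : ℕ) (a : R.ι i) :
    ∃ b : T.ι i, T.deg i b = R.deg i a := by
  obtain ⟨φ, ψ, h, hφg, -, -, -, -, hm⟩ := exists_comparison R T i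
  have h1 : ψ (φ (Finsupp.single a 1)) a ∉ mIdeal k V := fun h0 => by
    have h2 := sub_mem (sub_mem h0 (hm (Finsupp.single a 1) a))
      (R.d_apply_mem i (h (Finsupp.single a 1)) a)
    refine one_notMem_mIdeal (k := k) (V := V) ?_
    convert h2 using 1
    simp only [Finsupp.sub_apply, Finsupp.single_eq_same]
    ring
  have h3 : ∃ b, φ (Finsupp.single a 1) b ∉ mIdeal k V := by
    by_contra! hc
    exact h1 (map_apply_mem fun b => Ideal.mul_mem_right _ _ (hc b))
  obtain ⟨b, hb⟩ := h3
  refine ⟨b, ?_⟩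
  obtain h0 | ⟨e, he, hhom⟩ := hφg a b
  · exact absurd (h0 ▸ zero_mem _) hb
  · rw [mem_mIdeal_iff] at hb
    have := hhom hb
    simp at this
    omega

end MinFreeRes

end Comparison

end WOG

namespace WOG

section Taylor

variable (k : Type) [Field k] {V ε : Type} (m : ε → V →₀ ℕ)

/-- The exponent of the least common multiple of the monomials with exponents `m e`, `e ∈ σ`. -/
def lcmExp (σ : Finset ε) : V →₀ ℕ := σ.sup m

variable {m} in
theorem lcmExp_mono {σ τ : Finset ε} (h : σ ⊆ τ) : lcmExp m σ ≤ lcmExp m τ :=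
  Finset.sup_mono h

/-- The total module of the Taylor complex. -/
abbrev TaylorModule (k : Type) [Field k] (V ε : Type) : Type := Finset ε →₀ MvPolynomial V k

/-- The multiple of the basis element `σ` which has multidegree `μ`. -/
def taylorElem (σ : Finset ε) (μ : V →₀ ℕ) : TaylorModule k V ε :=
  Finsupp.single σ (monomial (μ - lcmExp m σ) 1)

theorem taylorElem_lcmExp (σ : Finset ε) :
    taylorElem k m σ (lcmExp m σ) = Finsupp.single σ 1 := by
  simp [taylorElem]

variable {m} in
theorem monomial_smul_taylorElem {σ : Finset ε} {μ ν : V →₀ ℕ} (h : lcmExp m σ ≤ μ) (hμ : μ ≤ ν) :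
    (monomial (ν - μ) (1 : k)) • taylorElem k m σ μ = taylorElem k m σ ν := by
  rw [taylorElem, Finsupp.smul_single, smul_eq_mul, monomial_mul, mul_one,
    tsub_add_tsub_cancel hμ h, taylorElem]

/-- The inclusion of the part of the Taylor complex spanned by the sets of cardinality `c`. -/
def taylorIncl (V ε : Type) (c : ℕ) : ({σ : Finset ε // σ.card = c} →₀ MvPolynomial V k)
    →ₗ[MvPolynomial V k] TaylorModule k V ε :=
  Finsupp.lmapDomain _ _ Subtype.val

variable {k} in
theorem taylorIncl_single {c : ℕ} (σ : {σ : Finset ε // σ.card = c}) (p : MvPolynomial V k) :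
    taylorIncl k V ε c (Finsupp.single σ p) = Finsupp.single σ.1 p :=
  Finsupp.mapDomain_single

variable {k} in
theorem taylorIncl_apply {c : ℕ} (x : {σ : Finset ε // σ.card = c} →₀ MvPolynomial V k)
    (σ : {σ : Finset ε // σ.card = c}) : taylorIncl k V ε c x σ.1 = x σ :=
  Finsupp.mapDomain_apply Subtype.val_injective x σ

theorem taylorIncl_injective (c : ℕ) : Function.Injective (taylorIncl k V ε c) :=
  Finsupp.mapDomain_injective Subtype.val_injective

variable {k} in
theorem taylorIncl_induction {c : ℕ} {P : TaylorModule k V ε → Prop} (zero : P 0)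
    (add : ∀ x y, P x → P y → P (x + y)) (smul : ∀ (a : k) x, P x → P (a • x))
    (elem : ∀ σ μ, σ.card = c → lcmExp m σ ≤ μ → P (taylorElem k m σ μ))
    (x : {σ : Finset ε // σ.card = c} →₀ MvPolynomial V k) : P (taylorIncl k V ε c x) := by
  induction x using Finsupp.induction_linear with
  | zero => simpa using zero
  | add x y hx hy =>
    rw [map_add]
    exact add _ _ hx hy
  | single σ p =>
    rw [taylorIncl_single]
    induction p using MvPolynomial.induction_on' with
    | monomial u a =>
      have h := smul a _ (elem σ.1 (u + lcmExp m σ.1) σ.2 le_add_self)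
      rwa [taylorElem, add_tsub_cancel_right, Finsupp.smul_single, smul_monomial, smul_eq_mul,
        mul_one] at h
    | add p q hp hq =>
      rw [Finsupp.single_add]
      exact add _ _ hp hq

variable [LinearOrder ε]

theorem lcmExp_erase_le (σ : Finset ε) (e : ε) : lcmExp m (σ.erase e) ≤ lcmExp m σ :=
  lcmExp_mono (Finset.erase_subset e σ)

/-- The sign of the face `σ \ {e}` of `σ`. -/
def faceSign (e : ε) (σ : Finset ε) : ℤ := (-1) ^ (σ.filter (· < e)).card

theorem faceSign_erase_of_lt {e e' : ε} (h : e < e') (σ : Finset ε) :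
    faceSign e (σ.erase e') = faceSign e σ := by
  unfold faceSign
  congr 2
  ext x
  simp only [Finset.mem_filter, Finset.mem_erase]
  constructor
  · rintro ⟨⟨-, h1⟩, h2⟩
    exact ⟨h1, h2⟩
  · rintro ⟨h1, h2⟩
    exact ⟨⟨(h2.trans h).ne, h1⟩, h2⟩

theorem faceSign_erase_of_gt {e e' : ε} {σ : Finset ε} (he' : e' ∈ σ) (h : e' < e) :
    faceSign e (σ.erase e') = -faceSign e σ := by
  unfold faceSign
  have h1 : e' ∈ σ.filter (· < e) := Finset.mem_filter.mpr ⟨he', h⟩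
  rw [Finset.filter_erase, ← Finset.card_erase_add_one h1, pow_succ]
  ring

theorem faceSign_insert_of_gt {e e' : ε} {σ : Finset ε} (he' : e' ∉ σ) (h : e' < e) :
    faceSign e (insert e' σ) = -faceSign e σ := by
  have := faceSign_erase_of_gt (Finset.mem_insert_self e' σ) h
  rw [Finset.erase_insert he'] at this
  rw [this, neg_neg]

theorem faceSign_eq_one {e : ε} {σ : Finset ε} (h : ∀ x ∈ σ, e ≤ x) : faceSign e σ = 1 := by
  unfold faceSign
  rw [Finset.filter_false_of_mem fun x hx => not_lt.mpr (h x hx)]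
  simp

theorem faceSign_mul_antisymm {e e' : ε} {σ : Finset ε} (he : e ∈ σ) (he' : e' ∈ σ)
    (hne : e ≠ e') :
    faceSign e σ * faceSign e' (σ.erase e) + faceSign e' σ * faceSign e (σ.erase e') = 0 := by
  rcases lt_or_gt_of_ne hne with h | h
  · rw [faceSign_erase_of_gt he h, faceSign_erase_of_lt h]
    ring
  · rw [faceSign_erase_of_lt h, faceSign_erase_of_gt he' h]
    ring

/-- The differential of the Taylor complex. -/
def taylorD : TaylorModule k V ε →ₗ[MvPolynomial V k] TaylorModule k V ε :=
  Finsupp.linearCombination (MvPolynomial V k) fun σ =>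
    ∑ e ∈ σ, faceSign e σ • taylorElem k m (σ.erase e) (lcmExp m σ)

theorem taylorD_single (σ : Finset ε) :
    taylorD k m (Finsupp.single σ 1) =
      ∑ e ∈ σ, faceSign e σ • taylorElem k m (σ.erase e) (lcmExp m σ) := by
  simp [taylorD]

variable {m} in
theorem taylorD_taylorElem {σ : Finset ε} {μ : V →₀ ℕ} (h : lcmExp m σ ≤ μ) :
    taylorD k m (taylorElem k m σ μ) = ∑ e ∈ σ, faceSign e σ • taylorElem k m (σ.erase e) μ := by
  rw [← monomial_smul_taylorElem k le_rfl h, map_smul, taylorElem_lcmExp, taylorD_single,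
    Finset.smul_sum]
  refine Finset.sum_congr rfl fun e _ => ?_
  rw [smul_comm, monomial_smul_taylorElem k (lcmExp_erase_le m σ e) h]

theorem taylorD_taylorD (x : TaylorModule k V ε) : taylorD k m (taylorD k m x) = 0 := by
  suffices H : taylorD k m ∘ₗ taylorD k m = 0 from LinearMap.congr_fun H x
  refine Finsupp.lhom_ext' fun σ => LinearMap.ext_ring ?_
  simp only [LinearMap.comp_apply, Finsupp.lsingle_apply, LinearMap.zero_apply]
  rw [taylorD_single, map_sum]
  have h1 : ∀ e ∈ σ, taylorD k m (faceSign e σ • taylorElem k m (σ.erase e) (lcmExp m σ)) =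
      ∑ e' ∈ σ.erase e, (faceSign e σ * faceSign e' (σ.erase e)) •
        taylorElem k m ((σ.erase e).erase e') (lcmExp m σ) := fun e _ => by
    rw [map_zsmul, taylorD_taylorElem k (lcmExp_erase_le m σ e), Finset.smul_sum]
    simp only [mul_smul]
  rw [Finset.sum_congr rfl h1, Finset.sum_sigma']
  refine Finset.sum_involution (fun p _ => ⟨p.2, p.1⟩) ?_ ?_ ?_ ?_
  · rintro ⟨e, e'⟩ hp
    simp only [Finset.mem_sigma, Finset.mem_erase] at hp
    rw [Finset.erase_right_comm (a := e'), ← add_smul,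
      faceSign_mul_antisymm hp.1 hp.2.2 (Ne.symm hp.2.1), zero_smul]
  · rintro ⟨e, e'⟩ hp - heq
    simp only [Finset.mem_sigma, Finset.mem_erase] at hp
    exact hp.2.1 (congrArg Sigma.fst heq)
  · rintro ⟨e, e'⟩ hp
    simp only [Finset.mem_sigma, Finset.mem_erase] at hp ⊢
    exact ⟨hp.2.2, Ne.symm hp.2.1, hp.1⟩
  · exact fun _ _ => rfl

theorem exists_taylorIncl_eq_taylorD {c : ℕ}
    (x : {σ : Finset ε // σ.card = c + 1} →₀ MvPolynomial V k) :
    ∃ y, taylorIncl k V ε c y = taylorD k m (taylorIncl k V ε (c + 1) x) := by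
  refine taylorIncl_induction m (P := fun x => ∃ y, taylorIncl k V ε c y = taylorD k m x)
    ⟨0, by simp⟩ ?_ ?_ ?_ x
  · rintro x y ⟨x', hx⟩ ⟨y', hy⟩
    exact ⟨x' + y', by rw [map_add, map_add, hx, hy]⟩
  · rintro a x ⟨x', hx⟩
    exact ⟨a • x', by rw [LinearMap.map_smul_of_tower, LinearMap.map_smul_of_tower, hx]⟩
  · intro σ μ hσ hμ
    rw [taylorD_taylorElem k hμ]
    refine Submodule.sum_mem (LinearMap.range (taylorIncl k V ε c)) fun e he => ?_
    refine zsmul_mem (S := Submodule (MvPolynomial V k) (TaylorModule k V ε)) ?_ _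
    have hcard : (σ.erase e).card = c := by rw [Finset.card_erase_of_mem he, hσ]; rfl
    exact ⟨Finsupp.single ⟨σ.erase e, hcard⟩ (monomial (μ - lcmExp m (σ.erase e)) 1),
      taylorIncl_single _ _⟩

/-- The differential of the Taylor complex from cardinality `c + 1` to cardinality `c`. -/
def taylorDiff (c : ℕ) : ({σ : Finset ε // σ.card = c + 1} →₀ MvPolynomial V k)
    →ₗ[MvPolynomial V k] ({σ : Finset ε // σ.card = c} →₀ MvPolynomial V k) :=
  Finsupp.lcomapDomain Subtype.val Subtype.val_injective ∘ₗ taylorD k m ∘ₗ taylorIncl k V ε (c + 1)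

theorem taylorDiff_apply (c : ℕ) (x : {σ : Finset ε // σ.card = c + 1} →₀ MvPolynomial V k)
    (σ : {σ : Finset ε // σ.card = c}) :
    taylorDiff k m c x σ = taylorD k m (taylorIncl k V ε (c + 1) x) σ.1 :=
  rfl

theorem taylorIncl_taylorDiff (c : ℕ)
    (x : {σ : Finset ε // σ.card = c + 1} →₀ MvPolynomial V k) :
    taylorIncl k V ε c (taylorDiff k m c x) = taylorD k m (taylorIncl k V ε (c + 1) x) := by
  obtain ⟨y, hy⟩ := exists_taylorIncl_eq_taylorD k m x
  rw [← hy]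
  congr 1
  ext1 σ
  rw [taylorDiff_apply, ← hy, taylorIncl_apply]

/-- The matrix entries of the differential of the Taylor complex. -/
theorem taylorDiff_single_apply (c : ℕ) (σ : {σ : Finset ε // σ.card = c + 1})
    (τ : {σ : Finset ε // σ.card = c}) :
    taylorDiff k m c (Finsupp.single σ 1) τ = ∑ e ∈ σ.1,
      if σ.1.erase e = τ.1 then faceSign e σ.1 • monomial (lcmExp m σ.1 - lcmExp m τ.1) (1 : k)
      else 0 := by
  rw [taylorDiff_apply, taylorIncl_single, taylorD_single, Finsupp.finsetSum_apply]
  refine Finset.sum_congr rfl fun e _ => ?_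
  rw [Finsupp.smul_apply, taylorElem, Finsupp.single_apply]
  split_ifs with h
  · rw [h]
  · rw [smul_zero]

theorem isShiftedHomog_taylorDiff_single (c : ℕ) (σ : {σ : Finset ε // σ.card = c + 1})
    (τ : {σ : Finset ε // σ.card = c}) :
    IsShiftedHomog (lcmExp m τ.1).degree (lcmExp m σ.1).degree
      (taylorDiff k m c (Finsupp.single σ 1) τ) := by
  rw [taylorDiff_single_apply]
  by_cases h : ∃ e ∈ σ.1, σ.1.erase e = τ.1
  · obtain ⟨e, -, he⟩ := h
    have hle : lcmExp m τ.1 ≤ lcmExp m σ.1 := he ▸ lcmExp_erase_le m σ.1 e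
    refine Or.inr ⟨(lcmExp m σ.1 - lcmExp m τ.1).degree, ?_, ?_⟩
    · rw [← map_add, add_tsub_cancel_of_le hle]
    · refine IsHomogeneous.sum _ _ _ fun e _ => ?_
      split_ifs
      · rw [← mem_homogeneousSubmodule]
        exact zsmul_mem (isHomogeneous_monomial 1 rfl) _
      · exact isHomogeneous_zero _ _ _
  · left
    refine Finset.sum_eq_zero fun e he => if_neg fun h' => h ⟨e, he, h'⟩

variable {m} in
theorem taylorDiff_single_mem (hm : ∀ σ, ∀ e ∈ σ, lcmExp m (σ.erase e) ≠ lcmExp m σ) (c : ℕ)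
    (σ : {σ : Finset ε // σ.card = c + 1}) (τ : {σ : Finset ε // σ.card = c}) :
    taylorDiff k m c (Finsupp.single σ 1) τ ∈ mIdeal k V := by
  rw [taylorDiff_single_apply]
  refine sum_mem fun e he => ?_
  split_ifs with h
  · classical
    refine zsmul_mem (mem_mIdeal_iff.mpr ?_) _
    rw [coeff_monomial, if_neg]
    intro h0
    rw [tsub_eq_zero_iff_le, ← h] at h0
    exact hm σ.1 e he (le_antisymm (lcmExp_erase_le m σ.1 e) h0)
  · exact zero_mem _

/-- The augmentation of the Taylor resolution. -/
def taylorAug : ({σ : Finset ε // σ.card = 1} →₀ MvPolynomial V k)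
    →ₗ[MvPolynomial V k] MvPolynomial V k :=
  Finsupp.lapply ⟨∅, Finset.card_empty⟩ ∘ₗ taylorDiff k m 0

theorem taylorAug_eq_zero_iff (x : {σ : Finset ε // σ.card = 1} →₀ MvPolynomial V k) :
    taylorAug k m x = 0 ↔ taylorDiff k m 0 x = 0 := by
  constructor
  · intro h
    ext1 ⟨σ, hσ⟩
    obtain rfl := Finset.card_eq_zero.mp hσ
    exact h
  · intro h
    rw [taylorAug, LinearMap.comp_apply, h, map_zero]

theorem taylorAug_single (e : ε) :
    taylorAug k m (Finsupp.single ⟨{e}, Finset.card_singleton e⟩ 1) = monomial (m e) 1 := by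
  rw [taylorAug, LinearMap.comp_apply, Finsupp.lapply_apply, taylorDiff_single_apply]
  rw [Finset.sum_singleton, if_pos (Finset.erase_singleton e), faceSign_eq_one (by simp), one_smul]
  simp [lcmExp, bot_eq_zero]

theorem range_taylorAug :
    LinearMap.range (taylorAug k m) = Ideal.span (Set.range fun e => monomial (m e) (1 : k)) := by
  apply le_antisymm
  · rintro _ ⟨x, rfl⟩
    induction x using Finsupp.induction_linear with
    | zero => simp
    | add x y hx hy => simpa using add_mem hx hy
    | single σ p =>
      obtain ⟨σ, hσ⟩ := σ
      obtain ⟨e, rfl⟩ := Finset.card_eq_one.mp hσ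
      rw [map_single_eq_mul, taylorAug_single]
      exact Ideal.mul_mem_left _ _ (Ideal.subset_span ⟨e, rfl⟩)
  · rw [Ideal.span_le]
    rintro _ ⟨e, rfl⟩
    exact ⟨_, taylorAug_single k m e⟩

variable [Fintype ε]

/-- The contracting homotopy of the Taylor complex on elements of multidegree `μ`: it adds to `σ`
the least generator dividing the monomial of exponent `μ`. -/
def taylorHVal (σ : Finset ε) (μ : V →₀ ℕ) : TaylorModule k V ε :=
  open scoped Classical in
  if h : (Finset.univ.filter fun e => m e ≤ μ).Nonempty then
    if (Finset.univ.filter fun e => m e ≤ μ).min' h ∈ σ then 0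
    else taylorElem k m (insert ((Finset.univ.filter fun e => m e ≤ μ).min' h) σ) μ
  else 0

/-- The contracting homotopy of the Taylor complex, which is only `k`-linear. -/
def taylorH : TaylorModule k V ε →ₗ[k] TaylorModule k V ε :=
  Finsupp.lsum k fun σ =>
    (basisMonomials V k).constr k fun u => taylorHVal k m σ (u + lcmExp m σ)

theorem taylorH_single (σ : Finset ε) (u : V →₀ ℕ) :
    taylorH k m (Finsupp.single σ (monomial u 1)) = taylorHVal k m σ (u + lcmExp m σ) := by
  rw [taylorH, Finsupp.lsum_single]
  have := (basisMonomials V k).constr_basis k (fun u => taylorHVal k m σ (u + lcmExp m σ)) u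
  rwa [coe_basisMonomials] at this

variable {m} in
theorem taylorH_taylorElem {σ : Finset ε} {μ : V →₀ ℕ} (h : lcmExp m σ ≤ μ) :
    taylorH k m (taylorElem k m σ μ) = taylorHVal k m σ μ := by
  rw [taylorElem, taylorH_single, tsub_add_cancel_of_le h]

variable {m} in
theorem taylorD_taylorH_add_taylorElem {σ : Finset ε} {μ : V →₀ ℕ} (hσ : σ.Nonempty)
    (h : lcmExp m σ ≤ μ) :
    taylorD k m (taylorH k m (taylorElem k m σ μ)) +
      taylorH k m (taylorD k m (taylorElem k m σ μ)) = taylorElem k m σ μ := by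
  classical
  have hle : ∀ e ∈ σ, m e ≤ μ := fun e he => (Finset.le_sup (f := m) he).trans h
  have hne : (Finset.univ.filter fun e => m e ≤ μ).Nonempty := by
    obtain ⟨e, he⟩ := hσ
    exact ⟨e, by simpa using hle e he⟩
  obtain ⟨c, hc⟩ : ∃ c, c = (Finset.univ.filter fun e => m e ≤ μ).min' hne := ⟨_, rfl⟩
  have hval : ∀ τ : Finset ε, taylorHVal k m τ μ =
      if c ∈ τ then 0 else taylorElem k m (insert c τ) μ := fun τ => by
    rw [taylorHVal, dif_pos (by convert hne), hc]
  have hcle : m c ≤ μ := by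
    have := Finset.min'_mem _ hne
    rw [← hc] at this
    simpa using this
  have hmin : ∀ e ∈ σ, c ≤ e := fun e he => by
    rw [hc]
    exact Finset.min'_le _ _ (by simpa using hle e he)
  have hHD : taylorH k m (taylorD k m (taylorElem k m σ μ)) =
      ∑ e ∈ σ, faceSign e σ •
        if c ∈ σ.erase e then 0 else taylorElem k m (insert c (σ.erase e)) μ := by
    rw [taylorD_taylorElem k h, map_sum]
    refine Finset.sum_congr rfl fun e _ => ?_
    rw [map_zsmul, taylorH_taylorElem k ((lcmExp_erase_le m σ e).trans h), hval]
  rw [taylorH_taylorElem k h, hval, hHD]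
  by_cases hcσ : c ∈ σ
  · rw [if_pos hcσ, map_zero, zero_add, Finset.sum_eq_single_of_mem c hcσ]
    · rw [if_neg (Finset.notMem_erase c σ), Finset.insert_erase hcσ, faceSign_eq_one hmin, one_smul]
    · intro e _ hec
      rw [if_pos (Finset.mem_erase.mpr ⟨Ne.symm hec, hcσ⟩), smul_zero]
  · have hins : lcmExp m (insert c σ) ≤ μ := by
      rw [lcmExp, Finset.sup_insert]
      exact sup_le hcle h
    rw [if_neg hcσ, taylorD_taylorElem k hins, Finset.sum_insert hcσ, Finset.erase_insert hcσ,
      faceSign_eq_one (by simpa using hmin), one_smul, add_assoc, ← Finset.sum_add_distrib,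
      Finset.sum_eq_zero, add_zero]
    intro e he
    have hce : c < e := lt_of_le_of_ne (hmin e he) fun h => hcσ (h ▸ he)
    rw [if_neg fun h => hcσ (Finset.mem_of_mem_erase h), faceSign_insert_of_gt hcσ hce,
      Finset.erase_insert_of_ne hce.ne, neg_smul, neg_add_cancel]

theorem exists_taylorIncl_eq_taylorH {c : ℕ}
    (x : {σ : Finset ε // σ.card = c} →₀ MvPolynomial V k) :
    ∃ y, taylorIncl k V ε (c + 1) y = taylorH k m (taylorIncl k V ε c x) := by
  classical
  refine taylorIncl_induction m (P := fun x => ∃ y, taylorIncl k V ε (c + 1) y = taylorH k m x)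
    ⟨0, by simp⟩ ?_ ?_ ?_ x
  · rintro x y ⟨x', hx⟩ ⟨y', hy⟩
    exact ⟨x' + y', by rw [map_add, map_add, hx, hy]⟩
  · rintro a x ⟨x', hx⟩
    exact ⟨a • x', by rw [LinearMap.map_smul_of_tower, map_smul, hx]⟩
  · intro σ μ hσ hμ
    rw [taylorH_taylorElem k hμ, taylorHVal]
    split_ifs with h1 h2
    · exact ⟨0, by simp⟩
    · exact ⟨Finsupp.single ⟨_, by rw [Finset.card_insert_of_notMem h2, hσ]⟩ _,
        taylorIncl_single _ _⟩
    · exact ⟨0, by simp⟩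

theorem taylorD_taylorH_add_taylorIncl {c : ℕ}
    (x : {σ : Finset ε // σ.card = c + 1} →₀ MvPolynomial V k) :
    taylorD k m (taylorH k m (taylorIncl k V ε (c + 1) x)) +
      taylorH k m (taylorD k m (taylorIncl k V ε (c + 1) x)) = taylorIncl k V ε (c + 1) x := by
  refine taylorIncl_induction m
    (P := fun x => taylorD k m (taylorH k m x) + taylorH k m (taylorD k m x) = x)
    (by simp) ?_ ?_ ?_ x
  · intro x y hx hy
    simp only [map_add]
    rw [add_add_add_comm, hx, hy]
  · intro a x hx
    rw [map_smul, LinearMap.map_smul_of_tower, LinearMap.map_smul_of_tower, map_smul, ← smul_add,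
      hx]
  · intro σ μ hσ hμ
    exact taylorD_taylorH_add_taylorElem k (Finset.card_pos.mp (by omega)) hμ

theorem exists_taylorD_eq_of_taylorD_eq_zero {c : ℕ}
    {x : {σ : Finset ε // σ.card = c + 1} →₀ MvPolynomial V k}
    (hx : taylorD k m (taylorIncl k V ε (c + 1) x) = 0) :
    ∃ y, taylorD k m (taylorIncl k V ε (c + 2) y) = taylorIncl k V ε (c + 1) x := by
  obtain ⟨y, hy⟩ := exists_taylorIncl_eq_taylorH k m x
  refine ⟨y, ?_⟩
  have h := taylorD_taylorH_add_taylorIncl k m x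
  rwa [hx, map_zero, add_zero, ← hy] at h

theorem range_taylorDiff (c : ℕ) :
    LinearMap.range (taylorDiff k m (c + 1)) = LinearMap.ker (taylorDiff k m c) := by
  ext x
  rw [LinearMap.mem_range, LinearMap.mem_ker]
  constructor
  · rintro ⟨y, rfl⟩
    apply taylorIncl_injective k
    rw [taylorIncl_taylorDiff, taylorIncl_taylorDiff, taylorD_taylorD, map_zero]
  · intro hx
    obtain ⟨y, hy⟩ := exists_taylorD_eq_of_taylorD_eq_zero k m (x := x)
      (by rw [← taylorIncl_taylorDiff, hx, map_zero])
    exact ⟨y, taylorIncl_injective k _ (by rw [taylorIncl_taylorDiff, hy])⟩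

variable {m} in
/-- The Taylor resolution of a monomial ideal, when it is minimal. -/
def taylorResolution (hm : ∀ σ, ∀ e ∈ σ, lcmExp m (σ.erase e) ≠ lcmExp m σ) :
    MinFreeRes (Ideal.span (Set.range fun e => monomial (m e) (1 : k))) where
  ι i := {σ : Finset ε // σ.card = i + 1}
  finite _ := inferInstance
  deg _ σ := (lcmExp m σ.1).degree
  aug := taylorAug k m
  d i := taylorDiff k m (i + 1)
  aug_range := range_taylorAug k m
  exact_zero := by
    rw [range_taylorDiff]
    ext x
    rw [LinearMap.mem_ker, LinearMap.mem_ker, taylorAug_eq_zero_iff]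
  exact_succ i := range_taylorDiff k m (i + 1)
  aug_homog := by
    rintro ⟨σ, hσ⟩
    obtain ⟨e, rfl⟩ := Finset.card_eq_one.mp hσ
    rw [taylorAug_single]
    exact isHomogeneous_monomial 1 (by simp [lcmExp])
  d_homog i := isShiftedHomog_taylorDiff_single k m (i + 1)
  minimal i := taylorDiff_single_mem k hm (i + 1)

end Taylor

end WOG

namespace WOG

section Successor

variable {V : Type} (s : V → V) (w : V → ℕ)

/-- The exponent of the generator `x * y ^ w y` of the edge ideal given by the edge from `x` to
`y = s x`. -/
def edgeExp (x : V) : V →₀ ℕ := Finsupp.single x 1 + Finsupp.single (s x) (w (s x))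

theorem edgeIdeal_eq_span (k : Type) [Field k] :
    edgeIdeal k {p : V × V | p.2 = s p.1} w =
      Ideal.span (Set.range fun x => monomial (edgeExp s w x) (1 : k)) := by
  have h : ∀ x, monomial (edgeExp s w x) (1 : k) = X x * X (s x) ^ w (s x) := fun x => by
    rw [X_pow_eq_monomial, X, monomial_mul, one_mul, edgeExp]
  rw [edgeIdeal]
  congr 1
  ext p
  constructor
  · rintro ⟨⟨x, y⟩, hxy, rfl⟩
    obtain rfl : y = s x := hxy
    exact ⟨x, h x⟩
  · rintro ⟨x, rfl⟩
    exact ⟨(x, s x), rfl, h x⟩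

variable {s w}

theorem lcmExp_apply_le_iff (σ : Finset V) (x : V) (N : ℕ) :
    lcmExp (edgeExp s w) σ x ≤ N ↔ ∀ e ∈ σ, edgeExp s w e x ≤ N := by
  classical
  induction σ using Finset.induction_on with
  | empty => simp [lcmExp, bot_eq_zero]
  | insert a σ ha ih =>
    rw [lcmExp] at ih
    rw [lcmExp, Finset.sup_insert, Finsupp.sup_apply, sup_le_iff, ih, Finset.forall_mem_insert]

theorem edgeExp_apply_succ (hne : ∀ x, s x ≠ x) (x : V) : edgeExp s w x (s x) = w (s x) := by
  simp [edgeExp, Finsupp.single_eq_of_ne (hne x)]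

theorem edgeExp_apply_succ_of_ne (hs : Function.Injective s) {x y : V} (h : x ≠ y) :
    edgeExp s w x (s y) ≤ 1 := by
  classical
  rw [edgeExp, Finsupp.add_apply, Finsupp.single_apply, Finsupp.single_apply,
    if_neg (hs.ne h)]
  split_ifs <;> omega

theorem le_lcmExp_apply_succ (hne : ∀ x, s x ≠ x) {σ : Finset V} {x : V} (hx : x ∈ σ) :
    w (s x) ≤ lcmExp (edgeExp s w) σ (s x) := by
  rw [← edgeExp_apply_succ (w := w) hne x]
  exact (lcmExp_apply_le_iff σ (s x) _).mp le_rfl x hx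

theorem lcmExp_apply_succ_le_one (hs : Function.Injective s) {σ : Finset V} {x : V}
    (hx : x ∉ σ) : lcmExp (edgeExp s w) σ (s x) ≤ 1 :=
  (lcmExp_apply_le_iff σ (s x) _).mpr fun _ he =>
    edgeExp_apply_succ_of_ne hs (ne_of_mem_of_not_mem he hx)

theorem lcmExp_apply_succ_le (hs : Function.Injective s) (hne : ∀ x, s x ≠ x)
    (hw : ∀ x, 2 ≤ w x) (σ : Finset V) (x : V) :
    lcmExp (edgeExp s w) σ (s x) ≤ w (s x) := by
  refine (lcmExp_apply_le_iff σ (s x) _).mpr fun e _ => ?_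
  by_cases h : e = x
  · rw [h, edgeExp_apply_succ hne]
  · exact (edgeExp_apply_succ_of_ne hs h).trans (one_le_two.trans (hw _))

theorem lcmExp_erase_ne [LinearOrder V] (hs : Function.Injective s) (hne : ∀ x, s x ≠ x)
    (hw : ∀ x, 2 ≤ w x) (σ : Finset V) (e : V) (he : e ∈ σ) :
    lcmExp (edgeExp s w) (σ.erase e) ≠ lcmExp (edgeExp s w) σ := fun h => by
  have h1 := lcmExp_apply_succ_le_one (w := w) hs (Finset.notMem_erase e σ)
  have h2 := le_lcmExp_apply_succ (w := w) hne he
  rw [h] at h1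
  have := hw (s e)
  omega

theorem MinFreeRes.mem_regSet_iff {k : Type} [Field k] {I : Ideal (MvPolynomial V k)}
    (R : MinFreeRes I) (t : ℤ) : t ∈ R.regSet ↔ ∃ i, ∃ a : R.ι i, t = (R.deg i a : ℤ) - i := by
  constructor
  · rintro ⟨i, j, hb, rfl⟩
    obtain ⟨⟨a, rfl⟩⟩ := (Nat.card_ne_zero.mp hb).1
    exact ⟨i, a, rfl⟩
  · rintro ⟨i, a, rfl⟩
    have := R.finite i
    exact ⟨i, R.deg i a, Nat.card_ne_zero.mpr ⟨⟨⟨a, rfl⟩⟩, inferInstance⟩, rfl⟩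

variable [Fintype V]

theorem degree_eq_sum_succ (hs : Function.Injective s) (u : V →₀ ℕ) :
    u.degree = ∑ x, u (s x) := by
  rw [Finsupp.degree_eq_sum]
  exact ((Finite.injective_iff_bijective.mp hs).sum_comp fun x => u x).symm

theorem sum_weight_succ (hs : Function.Injective s) : ∑ x, w (s x) = ∑ x, w x :=
  (Finite.injective_iff_bijective.mp hs).sum_comp w

theorem degree_lcmExp_univ (hs : Function.Injective s) (hne : ∀ x, s x ≠ x)
    (hw : ∀ x, 2 ≤ w x) :
    (lcmExp (edgeExp s w) Finset.univ).degree = ∑ x, w x := by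
  rw [degree_eq_sum_succ hs, ← sum_weight_succ (w := w) hs]
  exact Finset.sum_congr rfl fun x _ => le_antisymm (lcmExp_apply_succ_le hs hne hw _ x)
    (le_lcmExp_apply_succ hne (Finset.mem_univ x))

theorem degree_lcmExp_add_card_le (hs : Function.Injective s) (hne : ∀ x, s x ≠ x)
    (hw : ∀ x, 2 ≤ w x) (σ : Finset V) :
    (lcmExp (edgeExp s w) σ).degree + Fintype.card V ≤ ∑ x, w x + σ.card := by
  classical
  have hcard : σ.card = ∑ x, if x ∈ σ then 1 else 0 := by simp
  rw [degree_eq_sum_succ hs, ← sum_weight_succ (w := w) hs, hcard, Fintype.card_eq_sum_ones,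
    ← Finset.sum_add_distrib, ← Finset.sum_add_distrib]
  refine Finset.sum_le_sum fun x _ => ?_
  split_ifs with h
  · exact Nat.add_le_add_right (lcmExp_apply_succ_le hs hne hw σ x) 1
  · exact (Nat.add_le_add_right (lcmExp_apply_succ_le_one hs h) 1).trans (hw _)

theorem isGreatest_regSet {k : Type} [Field k] [LinearOrder V] [Nonempty V]
    (hs : Function.Injective s) (hne : ∀ x, s x ≠ x) (hw : ∀ x, 2 ≤ w x)
    (R : MinFreeRes (edgeIdeal k {p : V × V | p.2 = s p.1} w)) :
    IsGreatest R.regSet ((∑ x, (w x : ℤ)) - (Fintype.card V : ℤ) + 1) := by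
  revert R
  rw [edgeIdeal_eq_span]
  intro R
  let T := taylorResolution k (lcmExp_erase_ne (w := w) hs hne hw)
  constructor
  · rw [R.mem_regSet_iff]
    obtain ⟨i, hi⟩ := Nat.exists_eq_succ_of_ne_zero (Fintype.card_ne_zero (α := V))
    obtain ⟨b, hb⟩ := T.exists_deg_eq R i ⟨Finset.univ, hi⟩
    have hT : T.deg i ⟨Finset.univ, hi⟩ = ∑ x, w x := degree_lcmExp_univ hs hne hw
    refine ⟨i, b, ?_⟩
    rw [hb, hT, hi]
    push_cast
    ring
  · intro t ht
    obtain ⟨i, a, rfl⟩ := (R.mem_regSet_iff t).mp ht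
    obtain ⟨⟨σ, hσ⟩, hb⟩ := R.exists_deg_eq T i a
    have h : T.deg i ⟨σ, hσ⟩ + Fintype.card V ≤ ∑ x, w x + σ.card :=
      degree_lcmExp_add_card_le hs hne hw σ
    rw [← hb]
    zify at h
    rw [hσ] at h
    push_cast at h
    linarith

end Successor

end WOG

/-- **Corollary (oriented cycle, regularity).**
`D` is the vertex-weighted oriented cycle on `x_1, …, x_n` (`n ≥ 3`), with
edges `(x_1,x_2), …, (x_{n-1},x_n), (x_n,x_1)`, and every weight is `≥ 2`.
Then `reg I(D) = (∑_{x ∈ V} w(x)) - |E| + 1`. -/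
theorem oriented_cycle_reg (k : Type) [Field k] (n : ℕ) (hn : 3 ≤ n)
    (E : Set (Fin n × Fin n))
    (hE : E = {p : Fin n × Fin n | (p.2 : ℕ) = ((p.1 : ℕ) + 1) % n})
    (w : Fin n → ℕ) (hw2 : ∀ i : Fin n, 2 ≤ w i)
    (R : WOG.MinFreeRes (WOG.edgeIdeal k E w)) :
    IsGreatest R.regSet ((∑ i : Fin n, (w i : ℤ)) - (Nat.card ↥E : ℤ) + 1) := by
  subst hE
  let s : Fin n → Fin n := fun i => ⟨((i : ℕ) + 1) % n, Nat.mod_lt _ (by omega)⟩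
  have hset : {p : Fin n × Fin n | (p.2 : ℕ) = ((p.1 : ℕ) + 1) % n} = {p | p.2 = s p.1} := by
    ext p
    exact (Fin.ext_iff (a := p.2) (b := s p.1)).symm
  have hcases : ∀ i : Fin n, ((s i : ℕ) = i + 1 ∧ (i : ℕ) + 1 < n) ∨
      ((s i : ℕ) = 0 ∧ (i : ℕ) + 1 = n) := fun i => by
    rcases (Nat.succ_le_of_lt i.2).lt_or_eq with h | h
    · exact Or.inl ⟨Nat.mod_eq_of_lt h, h⟩
    · exact Or.inr ⟨(congrArg (· % n) h).trans (Nat.mod_self n), h⟩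
  have hs : Function.Injective s := fun i j hij => by
    have h := congrArg Fin.val hij
    rcases hcases i with h1 | h1 <;> rcases hcases j with h2 | h2 <;> ext <;> omega
  have hne : ∀ i, s i ≠ i := fun i hi => by
    have h := congrArg Fin.val hi
    rcases hcases i with h1 | h1 <;> omega
  have hcard : Nat.card {p : Fin n × Fin n | p.2 = s p.1} = Fintype.card (Fin n) := by
    rw [← Nat.card_eq_fintype_card]
    exact Nat.card_congr ⟨fun p => p.1.1, fun i => ⟨(i, s i), rfl⟩,
      fun ⟨⟨_, _⟩, h⟩ => Subtype.ext (Prod.ext rfl h.symm), fun _ => rfl⟩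
  have : Nonempty (Fin n) := ⟨⟨0, by omega⟩⟩
  revert R
  rw [hset, hcard]
  exact fun R => WOG.isGreatest_regSet hs hne hw2 R
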